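/- arXiv:1012.2724 — 2 statements merged into one kernel-verified Lean document; each statement's English description precedes it below -/
import Mathlib

section
/- Let R be a commutative ring and V a finitely generated free R-module. For each n ≥ 1, the Koszul complex 0 → Λ^n(V) → Λ^{n-1}(V) ⊗ Sym^1(V) → Λ^{n-2}(V) ⊗ Sym^2(V) → ⋯ → Λ^1(V) ⊗ Sym^{n-1}(V) → Sym^n(V) → 0, with differential induced by the comultiplication Λ^k → Λ^{k-1} ⊗ Λ^1 followed by the multiplication Λ^1 ⊗ Sym^ℓ = Sym^1 ⊗ Sym^ℓ → Sym^{ℓ+1}, is exact. -/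
open PiTensorProduct
open scoped TensorProduct

/-- Relations defining the symmetric power. -/
noncomputable def SymPow.rel (R : Type*) [CommRing R] (M : Type*) [AddCommGroup M]
    [Module R M] (n : ℕ) : Submodule R (⨂[R] (_ : Fin n), M) :=
  Submodule.span R {x | ∃ (σ : Equiv.Perm (Fin n)) (v : Fin n → M),
    x = tprod R v - PiTensorProduct.reindex R (fun _ => M) σ (tprod R v)}

/-- The `n`-th symmetric power of an `R`-module `M`. -/
noncomputable abbrev SymPow (R : Type*) [CommRing R] (M : Type*) [AddCommGroup M]
    [Module R M] (n : ℕ) :=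
  (⨂[R] (_ : Fin n), M) ⧸ SymPow.rel R M n

/-- The class of the product `v 0 ⋯ v (n-1)` in `Sym^n(M)`. -/
noncomputable def SymPow.mk (R : Type*) [CommRing R] (M : Type*) [AddCommGroup M]
    [Module R M] (n : ℕ) (v : Fin n → M) : SymPow R M n :=
  Submodule.Quotient.mk (tprod R v)

namespace KoszulAux

open Module

variable {R : Type*} [CommRing R] {V : Type*} [AddCommGroup V] [Module R V]

/-- The pure element `v₁∧⋯∧v_k ⊗ s₁⋯s_ℓ`. -/
noncomputable def G (R : Type*) [CommRing R] {V : Type*} [AddCommGroup V] [Module R V]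
    {k ℓ : ℕ} (v : Fin k → V) (s : Fin ℓ → V) :
    (⋀[R]^k V) ⊗[R] SymPow R V ℓ :=
  exteriorPower.ιMulti R k v ⊗ₜ[R] SymPow.mk R V ℓ s

lemma mk_perm {ℓ : ℕ} (s : Fin ℓ → V) (σ : Equiv.Perm (Fin ℓ)) :
    SymPow.mk R V ℓ (s ∘ σ) = SymPow.mk R V ℓ s := by
  symm
  unfold SymPow.mk
  rw [Submodule.Quotient.eq]
  apply Submodule.subset_span
  refine ⟨σ.symm, s, ?_⟩
  rw [PiTensorProduct.reindex_tprod]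
  rfl

lemma G_perm {k ℓ : ℕ} (v : Fin k → V) (s : Fin ℓ → V) (σ : Equiv.Perm (Fin ℓ)) :
    G R v (s ∘ σ) = G R v s := by
  unfold G; rw [mk_perm]

lemma cons_cons_swap {α : Type*} {ℓ : ℕ} (x y : α) (s : Fin ℓ → α) :
    (Fin.cons x (Fin.cons y s : Fin (ℓ + 1) → α) : Fin (ℓ + 2) → α) =
      (Fin.cons y (Fin.cons x s : Fin (ℓ + 1) → α) : Fin (ℓ + 2) → α) ∘ (Equiv.swap 0 1) := by
  funext i
  refine Fin.cases ?_ (fun i => ?_) i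
  · rw [Function.comp_apply, Equiv.swap_apply_left]
    rfl
  · refine Fin.cases ?_ (fun i => ?_) i
    · rw [Function.comp_apply, Fin.succ_zero_eq_one, Equiv.swap_apply_right]
      rfl
    · rw [Function.comp_apply, Equiv.swap_apply_of_ne_of_ne]
      · simp
      · exact Fin.succ_ne_zero _
      · intro h
        rw [← Fin.succ_zero_eq_one, Fin.succ_inj] at h
        exact Fin.succ_ne_zero _ h

lemma G_swap {k ℓ : ℕ} (v : Fin k → V) (x y : V) (s : Fin ℓ → V) :
    G R v (Fin.cons x (Fin.cons y s : Fin (ℓ + 1) → V)) =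
      G R v (Fin.cons y (Fin.cons x s : Fin (ℓ + 1) → V)) := by
  rw [cons_cons_swap, G_perm]

section ext
variable {ι : Type*} [LinearOrder ι] {N : Type*} [AddCommMonoid N] [Module R N]

lemma ext_alt {k : ℕ} (b : Basis ι R V) {A B : (⋀[R]^k V) →ₗ[R] N}
    (h : ∀ a : Fin k → ι, StrictMono a →
      A (exteriorPower.ιMulti R k (b ∘ a)) = B (exteriorPower.ιMulti R k (b ∘ a))) : A = B := by
  letI : AddCommGroup N := Module.addCommMonoidToAddCommGroup R
  apply exteriorPower.linearMap_ext
  refine Basis.ext_alternating b fun a ha => ?_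
  have h1 := h (a ∘ Tuple.sort a)
    ((Tuple.monotone_sort a).strictMono_of_injective (ha.comp (Equiv.injective _)))
  have h2 : exteriorPower.ιMulti R k (b ∘ a) =
      (((Equiv.Perm.sign (Tuple.sort a) : ℤˣ) : ℤ) : R) •
        exteriorPower.ιMulti R k (b ∘ (a ∘ Tuple.sort a)) := by
    rw [← Function.comp_assoc, AlternatingMap.map_perm]
    rcases Int.units_eq_one_or (Equiv.Perm.sign (Tuple.sort a)) with e | e <;> rw [e] <;> simp
  change A (exteriorPower.ιMulti R k (b ∘ a)) = B (exteriorPower.ιMulti R k (b ∘ a))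
  rw [h2, map_smul, map_smul, h1]

lemma ext_sym {ℓ : ℕ} (b : Basis ι R V) {A B : SymPow R V ℓ →ₗ[R] N}
    (h : ∀ s : Fin ℓ → ι, Monotone s → A (SymPow.mk R V ℓ (b ∘ s)) = B (SymPow.mk R V ℓ (b ∘ s))) :
    A = B := by
  letI : AddCommGroup N := Module.addCommMonoidToAddCommGroup R
  apply Submodule.linearMap_qext
  apply PiTensorProduct.ext
  refine Basis.ext_multilinear (fun _ => b) fun s => ?_
  have h1 := h _ (Tuple.monotone_sort s)
  rw [← Function.comp_assoc, mk_perm] at h1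
  exact h1

lemma ext_G {k ℓ : ℕ} (b : Basis ι R V) {A B : (⋀[R]^k V) ⊗[R] SymPow R V ℓ →ₗ[R] N}
    (h : ∀ (a : Fin k → ι) (s : Fin ℓ → ι), StrictMono a → Monotone s →
      A (G R (b ∘ a) (b ∘ s)) = B (G R (b ∘ a) (b ∘ s))) : A = B := by
  apply TensorProduct.ext
  refine ext_alt b fun a ha => ?_
  refine ext_sym b fun s hs => ?_
  exact h a s ha hs

lemma ext_G' {k ℓ : ℕ} {A B : (⋀[R]^k V) ⊗[R] SymPow R V ℓ →ₗ[R] N}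
    (h : ∀ (a : Fin k → V) (s : Fin ℓ → V), A (G R a s) = B (G R a s)) : A = B := by
  apply TensorProduct.ext
  refine LinearMap.ext_on (exteriorPower.ιMulti_span R k V) ?_
  rintro _ ⟨a, rfl⟩
  refine LinearMap.ext fun x => ?_
  refine Submodule.Quotient.induction_on _ x fun x => ?_
  have : ((TensorProduct.mk R (⋀[R]^k V) (SymPow R V ℓ)).compr₂ A (exteriorPower.ιMulti R k a)) ∘ₗ
      (SymPow.rel R V ℓ).mkQ =
      ((TensorProduct.mk R (⋀[R]^k V) (SymPow R V ℓ)).compr₂ B (exteriorPower.ιMulti R k a)) ∘ₗ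
      (SymPow.rel R V ℓ).mkQ := by
    apply PiTensorProduct.ext
    refine MultilinearMap.ext fun s => ?_
    exact h a s
  exact LinearMap.congr_fun this x

end ext

section homotopy
variable {ι : Type*} [LinearOrder ι] (b : Basis ι R V)

/-- The projection killing all `b i` with `i ≤ j`. -/
noncomputable def proj (j : ι) : V →ₗ[R] V := b.constr R fun i => if i ≤ j then 0 else b i

lemma proj_basis (j i : ι) : proj b j (b i) = if i ≤ j then 0 else b i := by
  simp [proj]

/-- `ω ↦ b j ∧ proj j ω`. -/
noncomputable def wedge (k : ℕ) (j : ι) : (⋀[R]^k V) →ₗ[R] (⋀[R]^(k + 1) V) :=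
  exteriorPower.alternatingMapLinearEquiv
    (((exteriorPower.ιMulti R (k + 1)).curryLeft (b j)).compLinearMap (proj b j))

lemma wedge_apply (k : ℕ) (j : ι) (v : Fin k → V) :
    wedge b k j (exteriorPower.ιMulti R k v) =
      exteriorPower.ιMulti R (k + 1) (Fin.cons (b j) (proj b j ∘ v)) := by
  rw [wedge, exteriorPower.alternatingMapLinearEquiv_apply_ιMulti]
  rfl

lemma wedge_zero (k : ℕ) (j : ι) (a : Fin k → ι) (i : Fin k) (hi : a i ≤ j) :
    wedge b k j (exteriorPower.ιMulti R k (b ∘ a)) = 0 := by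
  rw [wedge_apply]
  apply AlternatingMap.map_coord_zero _ i.succ
  simp [proj_basis, hi]

lemma wedge_pos (k : ℕ) (j : ι) (a : Fin k → ι) (h : ∀ i, j < a i) :
    wedge b k j (exteriorPower.ιMulti R k (b ∘ a)) =
      exteriorPower.ιMulti R (k + 1) (b ∘ (Fin.cons j a : Fin (k + 1) → ι)) := by
  rw [wedge_apply]
  congr 1
  funext i
  refine Fin.cases ?_ (fun i => ?_) i
  · simp
  · simp [proj_basis, (h i)]

/-- value of the homotopy on sorted tuples -/
noncomputable def hval (k ℓ : ℕ) (t : Fin (ℓ + 1) → ι) :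
    (⋀[R]^k V) →ₗ[R] (⋀[R]^(k + 1) V) ⊗[R] SymPow R V ℓ :=
  ((TensorProduct.mk R (⋀[R]^(k + 1) V) (SymPow R V ℓ)).flip
    (SymPow.mk R V ℓ (b ∘ Fin.tail t))) ∘ₗ wedge b k (t 0)

/-- the homotopy on the tensor power -/
noncomputable def hT (k ℓ : ℕ) : (⨂[R] (_ : Fin (ℓ + 1)), V) →ₗ[R]
    (⋀[R]^k V) →ₗ[R] (⋀[R]^(k + 1) V) ⊗[R] SymPow R V ℓ :=
  (Basis.piTensorProduct (fun _ : Fin (ℓ + 1) => b)).constr R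
    (fun s => hval b k ℓ (s ∘ Tuple.sort s))

lemma hT_apply (k ℓ : ℕ) (s : Fin (ℓ + 1) → ι) :
    hT b k ℓ (tprod R (b ∘ s)) = hval b k ℓ (s ∘ Tuple.sort s) := by
  have := (Basis.piTensorProduct (fun _ : Fin (ℓ + 1) => b)).constr_basis R
    (fun s => hval b k ℓ (s ∘ Tuple.sort s)) s
  rw [Basis.piTensorProduct_apply] at this
  exact this

lemma hT_rel (k ℓ : ℕ) : SymPow.rel R V (ℓ + 1) ≤ LinearMap.ker (hT b k ℓ) := by
  refine Submodule.span_le.2 ?_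
  rintro _ ⟨σ, v, rfl⟩
  have key : hT b k ℓ = hT b k ℓ ∘ₗ
      (PiTensorProduct.reindex R (fun _ : Fin (ℓ + 1) => V) σ).toLinearMap := by
    apply PiTensorProduct.ext
    refine Basis.ext_multilinear (fun _ => b) fun s => ?_
    change hT b k ℓ (tprod R (b ∘ s)) = hT b k ℓ (PiTensorProduct.reindex R (fun _ => V) σ
      (tprod R (b ∘ s)))
    rw [PiTensorProduct.reindex_tprod]
    change _ = hT b k ℓ (tprod R (b ∘ (s ∘ σ.symm)))
    rw [hT_apply, hT_apply, Tuple.comp_perm_comp_sort_eq_comp_sort]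
  have := LinearMap.congr_fun key (tprod R v)
  rw [LinearMap.comp_apply] at this
  have e : tprod R v - PiTensorProduct.reindex R (fun _ => V) σ (tprod R v) =
      tprod R v + (-1 : R) • PiTensorProduct.reindex R (fun _ => V) σ (tprod R v) := by
    rw [neg_one_smul, sub_eq_add_neg]
  rw [SetLike.mem_coe, LinearMap.mem_ker, e, map_add, map_smul, this]
  conv_lhs => enter [1]; rw [← one_smul R (hT b k ℓ _)]
  exact (add_smul _ _ _).symm.trans (by rw [add_neg_cancel, zero_smul])

/-- Descending a linear map to the symmetric power. -/
noncomputable def symLift {ℓ : ℕ} {N : Type*} [AddCommMonoid N] [Module R N]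
    (F : (⨂[R] (_ : Fin ℓ), V) →ₗ[R] N) (hF : SymPow.rel R V ℓ ≤ LinearMap.ker F) :
    SymPow R V ℓ →ₗ[R] N :=
  letI : AddCommGroup N := Module.addCommMonoidToAddCommGroup R
  (SymPow.rel R V ℓ).liftQ F hF

/-- The contracting homotopy. -/
noncomputable def h (k ℓ : ℕ) : (⋀[R]^k V) ⊗[R] SymPow R V (ℓ + 1) →ₗ[R]
    (⋀[R]^(k + 1) V) ⊗[R] SymPow R V ℓ :=
  TensorProduct.lift (symLift (hT b k ℓ) (hT_rel b k ℓ)).flip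

lemma h_apply (k ℓ : ℕ) (v : Fin k → V) (s : Fin (ℓ + 1) → ι) :
    h b k ℓ (G R v (b ∘ s)) = wedge b k ((s ∘ Tuple.sort s) 0) (exteriorPower.ιMulti R k v) ⊗ₜ[R]
      SymPow.mk R V ℓ (b ∘ Fin.tail (s ∘ Tuple.sort s)) := by
  have := LinearMap.congr_fun (hT_apply b k ℓ s) (exteriorPower.ιMulti R k v)
  exact this

lemma h_zero (k ℓ : ℕ) (a : Fin k → ι) (s : Fin (ℓ + 1) → ι) (i : Fin k)
    (hi : ∀ j, a i ≤ s j) : h b k ℓ (G R (b ∘ a) (b ∘ s)) = 0 := by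
  rw [h_apply, wedge_zero b k ((s ∘ Tuple.sort s) 0) a i (hi _), TensorProduct.zero_tmul]

lemma h_pos (k ℓ : ℕ) (a : Fin k → ι) (j : ι) (t : Fin ℓ → ι) (hj : ∀ i, j ≤ t i)
    (ha : ∀ i, j < a i) :
    h b k ℓ (G R (b ∘ a) (b ∘ (Fin.cons j t : Fin (ℓ + 1) → ι))) =
      G R (b ∘ (Fin.cons j a : Fin (k + 1) → ι)) (b ∘ t) := by
  have hs : (Fin.cons j t : Fin (ℓ + 1) → ι) ∘ (Equiv.Perm.decomposeFin.symm (0, Tuple.sort t)) =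
      Fin.cons j (t ∘ Tuple.sort t) := by
    funext i
    refine Fin.cases ?_ (fun i => ?_) i
    · simp
    · simp
  have hmono : Monotone (Fin.cons j (t ∘ Tuple.sort t) : Fin (ℓ + 1) → ι) := by
    intro x y
    refine Fin.cases ?_ (fun x => ?_) x
    · refine Fin.cases ?_ (fun y => ?_) y
      · simp
      · intro _; simpa using hj _
    · refine Fin.cases ?_ (fun y => ?_) y
      · intro h; simp at h
      · intro h
        simpa using Tuple.monotone_sort t (Fin.succ_le_succ_iff.1 h)
  have hsort := Tuple.comp_sort_eq_comp_iff_monotone.2 (hs ▸ hmono)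
  rw [h_apply, ← hsort, hs, Fin.tail_cons, Fin.cons_zero, wedge_pos b k j a ha,
    ← Function.comp_assoc, mk_perm]
  rfl

end homotopy

section main
variable (D : ∀ k ℓ : ℕ, (⋀[R]^(k + 1) V) ⊗[R] SymPow R V ℓ →ₗ[R]
    (⋀[R]^k V) ⊗[R] SymPow R V (ℓ + 1))
  (hD : ∀ (k ℓ : ℕ) (v : Fin (k + 1) → V) (s : Fin ℓ → V),
      D k ℓ (G R v s) = ∑ i : Fin (k + 1), ((-1 : ℤ) ^ (i : ℕ)) •
          G R (v ∘ i.succAbove) (Fin.cons (v i) s))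
include hD

lemma D_comp (k ℓ : ℕ) : D k (ℓ + 1) ∘ₗ D (k + 1) ℓ = 0 := by
  apply ext_G'
  intro v s
  rw [LinearMap.comp_apply, hD, map_sum, LinearMap.zero_apply]
  simp only [map_zsmul, hD, Finset.smul_sum, smul_smul]
  rw [← Finset.sum_product', Finset.univ_product_univ]
  refine Finset.sum_involution (fun p _ => (p.1.succAbove p.2, p.2.predAbove p.1)) ?_ ?_ ?_ ?_
  · rintro ⟨i, j⟩ _
    simp only [Function.comp_apply, Fin.succAbove_succAbove_predAbove]
    have h1 : (v ∘ (i.succAbove j).succAbove) ∘ (j.predAbove i).succAbove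
        = (v ∘ i.succAbove) ∘ j.succAbove := by
      funext x
      simp only [Function.comp_apply]
      rw [Fin.succAbove_succAbove_succAbove_predAbove]
    rw [h1, G_swap _ (v i), ← add_smul, ← pow_add, ← pow_add,
      Fin.neg_one_pow_succAbove_add_predAbove]
    simp
  · rintro ⟨i, j⟩ _ _ h
    exact Fin.succAbove_ne i j (congrArg Prod.fst h)
  · simp
  · rintro ⟨i, j⟩ _
    simp only [Fin.succAbove_succAbove_predAbove, Prod.mk.injEq, true_and]
    exact Fin.predAbove_predAbove_succAbove i j

variable {ι : Type*} [LinearOrder ι] (b : Basis ι R V)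

lemma hD_of_le (k ℓ : ℕ) (a : Fin (k + 1) → ι) (s : Fin ℓ → ι) (ha : StrictMono a)
    (hs : ∀ i, a 0 ≤ s i) :
    h b k ℓ (D k ℓ (G R (b ∘ a) (b ∘ s))) = G R (b ∘ a) (b ∘ s) := by
  have hc : ∀ j : ι, (Fin.cons (b j) (b ∘ s) : Fin (ℓ + 1) → V) = b ∘ (Fin.cons j s : Fin (ℓ + 1) → ι) :=
    fun j => (Fin.comp_cons _ _ _).symm
  rw [hD, map_sum, Fin.sum_univ_succ, Finset.sum_eq_zero, add_zero]
  · simp only [Function.comp_apply, hc, Function.comp_assoc]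
    rw [Fin.val_zero, pow_zero, one_smul, h_pos b k ℓ _ _ _ hs]
    · congr 2
      funext i
      refine Fin.cases ?_ (fun i => ?_) i <;> simp
    · intro i; exact ha (by simp)
  · intro i _
    simp only [Function.comp_apply, hc, Function.comp_assoc, map_zsmul]
    rcases k with _ | k
    · exact i.elim0
    rw [h_zero b _ ℓ _ _ 0, smul_zero]
    intro j
    have : (a ∘ i.succ.succAbove) 0 = a 0 := by simp
    rw [this]
    refine Fin.cases ?_ (fun j => ?_) j
    · exact ha.monotone (Fin.zero_le _)
    · exact hs j

lemma Dh_of_lt (k ℓ : ℕ) (a : Fin (k + 1) → ι) (j : ι) (t : Fin ℓ → ι)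
    (ha : ∀ i, j < a i) (ht : ∀ i, j ≤ t i) :
    D (k + 1) ℓ (h b (k + 1) ℓ (G R (b ∘ a) (b ∘ (Fin.cons j t : Fin (ℓ + 1) → ι)))) +
      h b k (ℓ + 1) (D k (ℓ + 1) (G R (b ∘ a) (b ∘ (Fin.cons j t : Fin (ℓ + 1) → ι)))) =
      G R (b ∘ a) (b ∘ (Fin.cons j t : Fin (ℓ + 1) → ι)) := by
  rw [h_pos b _ _ _ _ _ ht ha, hD, hD, map_sum, Fin.sum_univ_succ, add_assoc,
    ← Finset.sum_add_distrib, Finset.sum_eq_zero, add_zero]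
  · rw [Fin.val_zero, pow_zero, one_smul, Fin.comp_cons b j t]
    congr 1
  · intro i _
    rw [map_zsmul]
    have e1 : (b ∘ (Fin.cons j a : Fin (k + 2) → ι)) ∘ i.succ.succAbove =
        b ∘ (Fin.cons j (a ∘ i.succAbove) : Fin (k + 1) → ι) := by
      funext x
      refine Fin.cases ?_ (fun x => ?_) x <;> simp
    have e2 : G R ((b ∘ a) ∘ i.succAbove)
        (Fin.cons ((b ∘ a) i) (b ∘ (Fin.cons j t : Fin (ℓ + 1) → ι))) =
        G R (b ∘ (a ∘ i.succAbove))
          (b ∘ (Fin.cons j (Fin.cons (a i) t : Fin (ℓ + 1) → ι) : Fin (ℓ + 2) → ι)) := by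
      simp only [Fin.comp_cons]
      rw [G_swap]; rfl
    rw [e1, e2, h_pos]
    · simp only [Function.comp_apply, Fin.cons_succ, Fin.val_succ, pow_succ, Fin.comp_cons]
      simp
    · intro x
      refine Fin.cases ?_ (fun x => ?_) x
      · exact (ha i).le
      · exact ht x
    · intro x; exact ha _

lemma homotopy_mid (k ℓ : ℕ) :
    D (k + 1) ℓ ∘ₗ h b (k + 1) ℓ + h b k (ℓ + 1) ∘ₗ D k (ℓ + 1) = LinearMap.id := by
  refine ext_G b fun a s ha hs => ?_
  simp only [LinearMap.add_apply, LinearMap.comp_apply, LinearMap.id_apply]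
  rcases le_or_gt (a 0) (s 0) with hle | hlt
  · have hle' : ∀ i, a 0 ≤ s i := fun i => hle.trans (hs (Fin.zero_le i))
    rw [hD_of_le D hD b _ _ a s ha hle', h_zero b _ _ a s 0 hle', map_zero, zero_add]
  · have := Dh_of_lt D hD b k ℓ a (s 0) (Fin.tail s)
      (fun i => hlt.trans_le (ha.monotone (Fin.zero_le i))) (fun i => hs (Fin.zero_le _))
    rwa [Fin.cons_self_tail] at this

lemma homotopy_top (m : ℕ) : h b m 0 ∘ₗ D m 0 = LinearMap.id :=
  ext_G b fun a s ha _ => hD_of_le D hD b _ _ a s ha (fun i => i.elim0)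

lemma homotopy_bot (m : ℕ) : D 0 m ∘ₗ h b 0 m = LinearMap.id := by
  refine ext_G b fun a s _ hs => ?_
  have := h_pos b 0 m a (s 0) (Fin.tail s) (fun i => hs (Fin.zero_le _)) (fun i => i.elim0)
  rw [Fin.cons_self_tail] at this
  rw [LinearMap.comp_apply, this, hD, LinearMap.id_apply, Fin.sum_univ_succ, Fin.sum_univ_zero,
    add_zero, Fin.val_zero, pow_zero, one_smul]
  congr 1
  · change (Fin.cons (b (s 0)) (b ∘ Fin.tail s) : Fin (m + 1) → V) = _
    rw [← Fin.comp_cons, Fin.cons_self_tail]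

end main

end KoszulAux

/-- Let `R` be a commutative ring and `V` a finitely generated free
`R`-module.  The Koszul complex `0 → Λ^n(V) → Λ^{n-1}(V) ⊗ Sym^1(V) → ⋯ → Sym^n(V) → 0`,
with differential `(v₁∧⋯∧v_k) ⊗ s ↦ Σᵢ (−1)^{i} (v₁∧⋯v̂ᵢ⋯∧v_k) ⊗ (vᵢ·s)`, is exact:
the differential is injective at the top `Λ^{m+1}(V) ⊗ Sym^0(V)`, surjective onto the
bottom `Λ^0(V) ⊗ Sym^{m+1}(V)`, and `range = kernel` at every intermediate spot. -/
theorem koszul_complex_exact {R : Type*} [CommRing R] {V : Type*} [AddCommGroup V]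
    [Module R V] [Module.Free R V] [Module.Finite R V]
    (D : ∀ k ℓ : ℕ, (⋀[R]^(k + 1) V) ⊗[R] SymPow R V ℓ →ₗ[R] (⋀[R]^k V) ⊗[R] SymPow R V (ℓ + 1))
    (hD : ∀ (k ℓ : ℕ) (v : Fin (k + 1) → V) (s : Fin ℓ → V),
      D k ℓ ((⟨ExteriorAlgebra.ιMulti R (k + 1) v,
          ExteriorAlgebra.ιMulti_range R (k + 1) (Set.mem_range_self v)⟩ : ⋀[R]^(k + 1) V)
          ⊗ₜ[R] SymPow.mk R V ℓ s) =
        ∑ i : Fin (k + 1), ((-1 : ℤ) ^ (i : ℕ)) •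
          ((⟨ExteriorAlgebra.ιMulti R k (v ∘ i.succAbove),
              ExteriorAlgebra.ιMulti_range R k (Set.mem_range_self _)⟩ : ⋀[R]^k V)
            ⊗ₜ[R] SymPow.mk R V (ℓ + 1) (Fin.cons (v i) s))) :
    (∀ k ℓ : ℕ, LinearMap.range (D (k + 1) ℓ) = LinearMap.ker (D k (ℓ + 1))) ∧
    (∀ m : ℕ, Function.Injective (D m 0)) ∧
    (∀ m : ℕ, Function.Surjective (D 0 m)) := by
  have hD' : ∀ (k ℓ : ℕ) (v : Fin (k + 1) → V) (s : Fin ℓ → V),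
      D k ℓ (KoszulAux.G R v s) = ∑ i : Fin (k + 1), ((-1 : ℤ) ^ (i : ℕ)) •
          KoszulAux.G R (v ∘ i.succAbove) (Fin.cons (v i) s) := hD
  rcases subsingleton_or_nontrivial R with hR | hR
  · haveI : ∀ k ℓ, Subsingleton ((⋀[R]^k V) ⊗[R] SymPow R V ℓ) :=
      fun k ℓ => Module.subsingleton R _
    refine ⟨fun k ℓ => ?_, fun m => Function.injective_of_subsingleton _, fun m x => ⟨0, Subsingleton.elim _ _⟩⟩
    ext x
    rw [Subsingleton.elim x 0]
    simp
  have b := Module.finBasis R V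
  refine ⟨fun k ℓ => le_antisymm ?_ ?_, fun m => ?_, fun m => ?_⟩
  · rw [LinearMap.range_le_ker_iff]
    exact KoszulAux.D_comp D hD' k ℓ
  · intro x hx
    rw [LinearMap.mem_ker] at hx
    have := LinearMap.congr_fun (KoszulAux.homotopy_mid D hD' b k ℓ) x
    rw [LinearMap.add_apply, LinearMap.comp_apply, LinearMap.comp_apply, hx, map_zero, add_zero] at this
    exact ⟨_, this⟩
  · exact Function.LeftInverse.injective (LinearMap.congr_fun (KoszulAux.homotopy_top D hD' b m))
  · exact Function.RightInverse.surjective (LinearMap.congr_fun (KoszulAux.homotopy_bot D hD' b m))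
end

section
/- Let R be a commutative ring and V a finitely generated free R-module. For each n ≥ 1, the 'dual Koszul' complex 0 → Γ^n(V) → Γ^{n-1}(V) ⊗ Λ^1(V) → Γ^{n-2}(V) ⊗ Λ^2(V) → ⋯ → Γ^1(V) ⊗ Λ^{n-1}(V) → Λ^n(V) → 0 is exact, where Γ^k(V) = (V^{⊗k})^{Σ_k} is the k-th divided power (symmetric tensors), and the differential is induced by the comultiplication Γ^k → Γ^{k-1}⊗Γ^1 followed by the multiplication Γ^1 ⊗ Λ^ℓ = Λ^1 ⊗ Λ^ℓ → Λ^{ℓ+1}. -/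
open PiTensorProduct
open scoped TensorProduct

/-- The `n`-th divided power `Γ^n(M) = (M^{⊗n})^{Σ_n}`: the submodule of symmetric tensors in
the `n`-th tensor power of `M`. -/
noncomputable def DivPow (R : Type*) [CommRing R] (M : Type*) [AddCommGroup M] [Module R M]
    (n : ℕ) : Submodule R (⨂[R] (_ : Fin n), M) :=
  ⨅ σ : Equiv.Perm (Fin n),
    LinearMap.ker ((PiTensorProduct.reindex R (fun _ => M) σ).toLinearMap - LinearMap.id)

namespace DualKoszul

set_option linter.unusedSectionVars false

open Module

section comb

variable {ι : Type*} [LinearOrder ι] {R : Type*} [CommRing R]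

/-- The multiset underlying a word. -/
def mw {k : ℕ} (w : Fin k → ι) : Multiset ι := (List.ofFn w : Multiset ι)

lemma mw_snoc {k : ℕ} (w : Fin k → ι) (i : ι) :
    mw (Fin.snoc w i : Fin (k + 1) → ι) = i ::ₘ mw w := by
  unfold mw
  rw [List.ofFn_succ']
  simp only [Fin.snoc_castSucc, Fin.snoc_last, List.concat_eq_append]
  rw [← Multiset.coe_add, add_comm]
  rfl

lemma mw_perm {k : ℕ} (w : Fin k → ι) (σ : Equiv.Perm (Fin k)) : mw (w ∘ σ) = mw w :=
  Multiset.coe_eq_coe.2 (Equiv.Perm.ofFn_comp_perm σ w)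

lemma exists_perm {k : ℕ} (w w₂ : Fin k → ι) (h : mw w = mw w₂) :
    ∃ σ : Equiv.Perm (Fin k), w₂ = w ∘ σ := by
  have h1 : w ∘ Tuple.sort w = w₂ ∘ Tuple.sort w₂ := by
    apply List.ofFn_injective
    apply List.Perm.eq_of_pairwise (le := (· ≤ ·))
    · intro a b _ _ h1 h2
      exact le_antisymm h1 h2
    · exact (Tuple.monotone_sort w).sortedLE_ofFn.pairwise
    · exact (Tuple.monotone_sort w₂).sortedLE_ofFn.pairwise
    · rw [← Multiset.coe_eq_coe]
      change mw _ = mw _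
      rw [mw_perm, mw_perm, h]
  refine ⟨(Tuple.sort w₂).symm.trans (Tuple.sort w), ?_⟩
  funext i
  have := congrFun h1 ((Tuple.sort w₂).symm i)
  simpa using this.symm

lemma exists_word {k : ℕ} (m : Multiset ι) (hm : m.card = k) : ∃ w : Fin k → ι, mw w = m := by
  subst hm
  induction m using Quotient.inductionOn with
  | h l => exact ⟨l.get, by simp [mw]⟩

lemma card_mw {k : ℕ} (w : Fin k → ι) : (mw w).card = k := by simp [mw]

/-- The Koszul differential on coordinate functions. -/
def dc {ℓ : ℕ} (F : Multiset ι → (Fin ℓ → ι) → R) (m : Multiset ι) (s : Fin (ℓ + 1) → ι) : R :=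
  ∑ j : Fin (ℓ + 1), (-1) ^ (j : ℕ) * F (s j ::ₘ m) (j.removeNth s)

lemma dc_dc {ℓ : ℕ} (F : Multiset ι → (Fin ℓ → ι) → R) (m : Multiset ι)
    (s : Fin (ℓ + 2) → ι) : dc (dc F) m s = 0 := by
  simp only [dc, Finset.mul_sum, Fin.sum_sum_eq_sum_triangle_add]
  refine Finset.sum_eq_zero fun i _ ↦ Finset.sum_eq_zero fun j hj ↦ ?_
  rw [Finset.mem_Ici] at hj
  have H₁ : i.castSucc.removeNth s j = s j.succ := by
    simp [Fin.removeNth_apply, Fin.succAbove_of_le_castSucc, hj]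
  have H₂ : j.succ.removeNth s i = s i.castSucc := by
    simp [Fin.removeNth_apply, Fin.succAbove_of_castSucc_lt, hj]
  have H₃ : j.removeNth (i.castSucc.removeNth s) = i.removeNth (j.succ.removeNth s) := by
    rw [Fin.removeNth_removeNth_eq_swap]
    have h1 : i.castSucc.succAbove j = j.succ := by simp [Fin.succAbove_of_le_castSucc, hj]
    have h2 : j.predAbove i.castSucc = i := by simp [Fin.predAbove_of_le_castSucc, hj]
    rw [h1, h2]
  rw [H₁, H₂, H₃, Multiset.cons_swap]
  simp only [Fin.val_castSucc, Fin.val_succ]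
  ring

/-- `i` is the minimum of `m` and `s`, lies in `m`, and does not lie in `s`. -/
def P {ℓ : ℕ} (m : Multiset ι) (s : Fin ℓ → ι) (i : ι) : Prop :=
  i ∈ m ∧ (∀ j ∈ m, i ≤ j) ∧ ∀ j, i < s j

open Classical in
/-- The contracting homotopy. -/
noncomputable def hc {ℓ : ℕ} (F : Multiset ι → (Fin (ℓ + 1) → ι) → R) (m : Multiset ι)
    (s : Fin ℓ → ι) : R :=
  if h : ∃ i, P m s i then F (m.erase h.choose) (Fin.cons h.choose s) else 0

lemma hc_of {ℓ : ℕ} (F : Multiset ι → (Fin (ℓ + 1) → ι) → R) (m : Multiset ι)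
    (s : Fin ℓ → ι) (i : ι) (hi : P m s i) : hc F m s = F (m.erase i) (Fin.cons i s) := by
  have h : ∃ i, P m s i := ⟨i, hi⟩
  have : h.choose = i := le_antisymm (h.choose_spec.2.1 _ hi.1) (hi.2.1 _ h.choose_spec.1)
  rw [hc, dif_pos h, this]

lemma hc_of_not {ℓ : ℕ} (F : Multiset ι → (Fin (ℓ + 1) → ι) → R) (m : Multiset ι)
    (s : Fin ℓ → ι) (h : ¬ ∃ i, P m s i) : hc F m s = 0 := by
  rw [hc, dif_neg h]

lemma hc_zero {ℓ k : ℕ} (F : Multiset ι → (Fin (ℓ + 1) → ι) → R)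
    (hF : ∀ m s, m.card = k → F m s = 0) (m : Multiset ι) (hm : m.card = k + 1)
    (s : Fin ℓ → ι) : hc F m s = 0 := by
  by_cases h : ∃ i, P m s i
  · obtain ⟨i, hi⟩ := h
    rw [hc_of F m s i hi]
    apply hF
    rw [Multiset.card_erase_of_mem hi.1, hm]
    rfl
  · exact hc_of_not F m s h

lemma exists_min (m : Multiset ι) (hm : m ≠ 0) : ∃ i ∈ m, ∀ j ∈ m, i ≤ j := by
  have := m.toFinset.exists_min_image id (by simpa [Finset.nonempty_iff_ne_empty] using hm)
  simpa using this

lemma homotopy_zero (F : Multiset ι → (Fin 0 → ι) → R) (m : Multiset ι) (hm : m ≠ 0)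
    (s : Fin 0 → ι) : hc (dc F) m s = F m s := by
  obtain ⟨i, hi, hii⟩ := exists_min m hm
  rw [hc_of _ m s i ⟨hi, hii, fun j => j.elim0⟩]
  simp [dc, Multiset.cons_erase hi]

lemma homotopy {ℓ : ℕ} (F : Multiset ι → (Fin (ℓ + 1) → ι) → R) (m : Multiset ι)
    (s : Fin (ℓ + 1) → ι) (hs : StrictMono s) :
    dc (hc F) m s + hc (dc F) m s = F m s := by
  by_cases h : ∃ i, P m s i
  · obtain ⟨i, hi⟩ := h
    rw [hc_of _ m s i hi, dc, dc, Fin.sum_univ_succ (n := ℓ + 1)]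
    have h1 : ∀ j, hc F (s j ::ₘ m) (j.removeNth s) =
        F (s j ::ₘ m.erase i) (Fin.cons i (j.removeNth s)) := by
      intro j
      rw [hc_of F _ _ i, Multiset.erase_cons_tail _ (hi.2.2 j).ne']
      refine ⟨Multiset.mem_cons_of_mem hi.1, ?_, fun jj => hi.2.2 _⟩
      intro jj hjj
      rcases Multiset.mem_cons.1 hjj with rfl | hjj
      · exact (hi.2.2 j).le
      · exact hi.2.1 _ hjj
    have h2 : ∀ j : Fin (ℓ + 1), j.succ.removeNth (Fin.cons i s : Fin (ℓ + 2) → ι) =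
        Fin.cons i (j.removeNth s) := by
      intro j
      funext x
      refine Fin.cases ?_ (fun x => ?_) x
      · simp [Fin.removeNth]
      · simp [Fin.removeNth]
    have h3 : (0 : Fin (ℓ + 2)).removeNth (Fin.cons i s : Fin (ℓ + 2) → ι) = s := by
      funext x
      simp [Fin.removeNth]
    simp only [h1, h2, h3, Fin.cons_succ, Fin.cons_zero, Multiset.cons_erase hi.1, Fin.val_succ,
      pow_succ, Fin.val_zero, pow_zero, one_mul, mul_neg, neg_mul, mul_one, Finset.sum_neg_distrib]
    ring
  · rw [hc_of_not _ m s h, add_zero, dc, Fin.sum_univ_succ, Finset.sum_eq_zero, add_zero]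
    · have h0 : ∀ j ∈ m, s 0 ≤ j := by
        intro j hj
        by_contra hlt
        push Not at hlt
        obtain ⟨i, hi, hii⟩ := exists_min m (by rintro rfl; simp at hj)
        exact h ⟨i, hi, hii, fun x =>
          lt_of_le_of_lt (hii j hj) (lt_of_lt_of_le hlt (hs.monotone (Fin.zero_le x)))⟩
      rw [hc_of F _ _ (s 0)]
      · have : (Fin.cons (s 0) ((0 : Fin (ℓ + 1)).removeNth s) : Fin (ℓ + 1) → ι) = s := by
          funext x
          refine Fin.cases ?_ (fun x => ?_) x
          · simp
          · simp [Fin.tail]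
        rw [this]
        simp
      · refine ⟨by simp, ?_, ?_⟩
        · intro j hj
          rcases Multiset.mem_cons.1 hj with rfl | hj
          · exact le_rfl
          · exact h0 _ hj
        · intro j
          exact hs (by simp [Fin.pos_iff_ne_zero])
    · intro j _
      rw [hc_of_not, mul_zero]
      rintro ⟨i, hi⟩
      have hlt : i < s 0 := by
        rcases ℓ with _ | ℓ
        · exact j.elim0
        · have := hi.2.2 0
          simpa [Fin.removeNth, Fin.succ_succAbove_zero] using this
      have him : i ∈ m := by
        rcases Multiset.mem_cons.1 hi.1 with hh | hh
        · exact absurd (hh ▸ hlt) (not_lt.2 (hs.monotone (Fin.zero_le _)))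
        · exact hh
      exact h ⟨i, him, fun x hx => hi.2.1 x (Multiset.mem_cons_of_mem hx), fun x =>
        lt_of_lt_of_le hlt (hs.monotone (Fin.zero_le _))⟩

end comb

end DualKoszul
namespace DualKoszul
open Module
lemma inj_of_ker {R M N : Type*} [CommRing R] [AddCommMonoid M] [AddCommMonoid N] [Module R M]
    [Module R N] (f : M →ₗ[R] N) (h : ∀ x, f x = 0 → x = 0) : Function.Injective f := by
  let := Module.addCommMonoidToAddCommGroup R (M := M)
  let := Module.addCommMonoidToAddCommGroup R (M := N)
  exact (injective_iff_map_eq_zero f).2 h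

set_option linter.unusedSectionVars false

section coords

variable {ι : Type*} [LinearOrder ι] [Fintype ι] {R : Type*} [CommRing R]
  {V : Type*} [AddCommGroup V] [Module R V] (b : Basis ι R V)

/-- Coordinates on the exterior power. -/
noncomputable def cL {ℓ : ℕ} (s : Fin ℓ → ι) : ⋀[R]^ℓ V →ₗ[R] R :=
  exteriorPower.pairingDual R V ℓ (exteriorPower.ιMulti R ℓ (fun j => b.coord (s j)))

/-- Coordinates on the tensor power. -/
noncomputable def cT {k : ℕ} (w : Fin k → ι) : (⨂[R] (_ : Fin k), V) →ₗ[R] R :=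
  (Basis.piTensorProduct (fun _ : Fin k => b)).coord w

/-- Coordinates on the tensor product of a tensor power and an exterior power. -/
noncomputable def C {k ℓ : ℕ} (w : Fin k → ι) (s : Fin ℓ → ι) :
    (⨂[R] (_ : Fin k), V) ⊗[R] (⋀[R]^ℓ V) →ₗ[R] R :=
  (LinearMap.mul' R R).comp (TensorProduct.map (cT b w) (cL b s))

lemma C_tmul {k ℓ : ℕ} (w : Fin k → ι) (s : Fin ℓ → ι) (x : ⨂[R] (_ : Fin k), V)
    (y : ⋀[R]^ℓ V) : C b w s (x ⊗ₜ y) = cT b w x * cL b s y := by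
  simp [C]

lemma cT_tprod {k : ℕ} (w : Fin k → ι) (v : Fin k → V) :
    cT b w (tprod R v) = ∏ i, b.repr (v i) (w i) := by
  simp [cT]

lemma cL_cons {ℓ : ℕ} (s : Fin (ℓ + 1) → ι) (v : V) (w : Fin ℓ → V) :
    cL b s (exteriorPower.ιMulti R (ℓ + 1) (Fin.cons v w)) =
      ∑ j : Fin (ℓ + 1), (-1) ^ (j : ℕ) * (b.repr v (s j) *
        cL b (j.removeNth s) (exteriorPower.ιMulti R ℓ w)) := by
  simp only [cL, exteriorPower.pairingDual_ιMulti_ιMulti]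
  rw [Matrix.det_succ_row_zero]
  refine Finset.sum_congr rfl fun j _ => ?_
  rw [mul_assoc]
  rfl

lemma C_E {k ℓ : ℕ} (E : (⨂[R] (_ : Fin (k + 1)), V) ⊗[R] (⋀[R]^ℓ V) →ₗ[R]
      (⨂[R] (_ : Fin k), V) ⊗[R] (⋀[R]^(ℓ + 1) V))
    (hE : ∀ (v : Fin (k + 1) → V) (w : Fin ℓ → V),
      E ((tprod R v) ⊗ₜ[R] (exteriorPower.ιMulti R ℓ w)) =
        (tprod R (v ∘ Fin.castSucc)) ⊗ₜ[R]
          (exteriorPower.ιMulti R (ℓ + 1) (Fin.cons (v (Fin.last k)) w)))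
    (w : Fin k → ι) (s : Fin (ℓ + 1) → ι) (y : (⨂[R] (_ : Fin (k + 1)), V) ⊗[R] (⋀[R]^ℓ V)) :
    C b w s (E y) = ∑ j : Fin (ℓ + 1), (-1) ^ (j : ℕ) *
      C b (Fin.snoc w (s j) : Fin (k + 1) → ι) (j.removeNth s) y := by
  have key : (C b w s).comp E = ∑ j : Fin (ℓ + 1), ((-1) ^ (j : ℕ) : R) •
      C b (Fin.snoc w (s j) : Fin (k + 1) → ι) (j.removeNth s) := by
    apply TensorProduct.ext
    apply PiTensorProduct.ext
    ext v u
    simp only [LinearMap.compMultilinearMap_apply, LinearMap.compAlternatingMap_apply,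
      LinearMap.compr₂ₛₗ_apply,
      TensorProduct.mk_apply, LinearMap.comp_apply, hE, LinearMap.sum_apply, LinearMap.smul_apply,
      C_tmul, cT_tprod, cL_cons, smul_eq_mul, Finset.mul_sum]
    refine Finset.sum_congr rfl fun j _ => ?_
    rw [Fin.prod_univ_castSucc]
    simp only [Fin.snoc_castSucc, Fin.snoc_last, Function.comp_apply]
    ring
  have := LinearMap.congr_fun key y
  simpa using this

lemma cL_eq_repr {ℓ : ℕ} (S : Set.powersetCard ι ℓ) (x : ⋀[R]^ℓ V) :
    (b.exteriorPower ℓ).repr x S = cL b (Set.powersetCard.ofFinEmbEquiv.symm S) x := by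
  rw [exteriorPower.basis_repr_apply]
  rfl

lemma C_sep {k ℓ : ℕ} (x y : (⨂[R] (_ : Fin k), V) ⊗[R] (⋀[R]^ℓ V))
    (h : ∀ (w : Fin k → ι) (s : Fin ℓ → ι), StrictMono s → C b w s x = C b w s y) : x = y := by
  apply ((Basis.piTensorProduct (fun _ : Fin k => b)).tensorProduct (b.exteriorPower ℓ)).ext_elem
  rintro ⟨w, S⟩
  have key : ∀ z, ((Basis.piTensorProduct (fun _ : Fin k => b)).tensorProduct
      (b.exteriorPower ℓ)).repr z (w, S) =
      C b w (Set.powersetCard.ofFinEmbEquiv.symm S) z := by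
    intro z
    induction z using TensorProduct.induction_on with
    | zero => simp
    | tmul x y =>
      rw [Basis.tensorProduct_repr_tmul_apply, C_tmul, cL_eq_repr, smul_eq_mul, mul_comm]
      rfl
    | add x y hx hy => simp only [map_add, Finsupp.add_apply, hx, hy]
  rw [key, key]
  exact h _ _ (OrderEmbedding.strictMono _)

/-- The inclusion of symmetric tensors. -/
noncomputable def incl (R V : Type*) [CommRing R] [AddCommGroup V] [Module R V] (k ℓ : ℕ) :
    (DivPow R V k) ⊗[R] (⋀[R]^ℓ V) →ₗ[R] (⨂[R] (_ : Fin k), V) ⊗[R] (⋀[R]^ℓ V) :=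
  TensorProduct.map (DivPow R V k).subtype LinearMap.id

lemma incl_injective {ι : Type*} [LinearOrder ι] {R : Type*} [CommRing R]
    {V : Type*} [AddCommGroup V] [Module R V] (b : Basis ι R V) (k ℓ : ℕ) : Function.Injective (incl R V k ℓ) := by
  have : Module.Free R (⋀[R]^ℓ V) := Module.Free.of_basis (b.exteriorPower ℓ)
  exact Module.Flat.rTensor_preserves_injective_linearMap (M := ⋀[R]^ℓ V)
    (DivPow R V k).subtype (Submodule.subtype_injective _)

lemma mem_DivPow {k : ℕ} (x : ⨂[R] (_ : Fin k), V) :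
    x ∈ DivPow R V k ↔ ∀ σ : Equiv.Perm (Fin k),
      PiTensorProduct.reindex R (fun _ => V) σ x = x := by
  simp [DivPow, Submodule.mem_iInf, sub_eq_zero]

lemma cT_reindex {k : ℕ} (w : Fin k → ι) (σ : Equiv.Perm (Fin k)) (x : ⨂[R] (_ : Fin k), V) :
    cT b w (PiTensorProduct.reindex R (fun _ => V) σ x) = cT b (w ∘ σ) x := by
  have key : (cT b w).comp (PiTensorProduct.reindex R (fun _ => V) σ).toLinearMap =
      cT b (w ∘ σ) := by
    apply PiTensorProduct.ext
    ext v
    simp only [LinearMap.compMultilinearMap_apply, LinearMap.comp_apply, LinearEquiv.coe_coe]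
    erw [PiTensorProduct.reindex_tprod, cT_tprod, cT_tprod]
    rw [← Equiv.prod_comp σ]
    refine Finset.prod_congr rfl fun i _ => ?_
    rw [σ.symm_apply_apply]
    rfl
  exact LinearMap.congr_fun key x

lemma C_symm {k ℓ : ℕ} (w : Fin k → ι) (σ : Equiv.Perm (Fin k)) (s : Fin ℓ → ι)
    (x : (DivPow R V k) ⊗[R] (⋀[R]^ℓ V)) :
    C b (w ∘ σ) s (incl R V k ℓ x) = C b w s (incl R V k ℓ x) := by
  induction x using TensorProduct.induction_on with
  | zero => simp
  | tmul x y =>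
    simp only [incl, TensorProduct.map_tmul, C_tmul, Submodule.subtype_apply]
    rw [← cT_reindex, (mem_DivPow _).1 x.2 σ]
  | add x y hx hy => simp only [map_add, hx, hy]

lemma exists_F {k ℓ : ℕ} (x : (DivPow R V k) ⊗[R] (⋀[R]^ℓ V)) :
    ∃ F : Multiset ι → (Fin ℓ → ι) → R, ∀ (w : Fin k → ι) (s : Fin ℓ → ι),
      C b w s (incl R V k ℓ x) = F (mw w) s := by
  classical
  refine ⟨fun m s => if h : ∃ w : Fin k → ι, mw w = m then C b h.choose s (incl R V k ℓ x) else 0,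
    fun w s => ?_⟩
  have h : ∃ w₂ : Fin k → ι, mw w₂ = mw w := ⟨w, rfl⟩
  simp only [dif_pos h]
  obtain ⟨σ, hσ⟩ := exists_perm _ _ h.choose_spec
  conv_lhs => rw [hσ]
  exact C_symm b _ σ s x

lemma exists_real (k : ℕ) {ℓ : ℕ} (F : Multiset ι → (Fin ℓ → ι) → R) :
    ∃ x : (DivPow R V k) ⊗[R] (⋀[R]^ℓ V), ∀ (w : Fin k → ι) (s : Fin ℓ → ι), StrictMono s →
      C b w s (incl R V k ℓ x) = F (mw w) s := by
  classical
  have h1 : ∀ (f : Multiset ι → R), ∃ x : DivPow R V k, ∀ w : Fin k → ι,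
      cT b w (x : ⨂[R] (_ : Fin k), V) = f (mw w) := by
    intro f
    let B := Basis.piTensorProduct (fun _ : Fin k => b)
    have hB : ∀ w : Fin k → ι, cT b w (B.equivFun.symm (fun w => f (mw w))) = f (mw w) := by
      intro w
      change B.equivFun (B.equivFun.symm _) w = _
      rw [LinearEquiv.apply_symm_apply]
    refine ⟨⟨B.equivFun.symm (fun w => f (mw w)), ?_⟩, hB⟩
    rw [mem_DivPow]
    intro σ
    apply B.ext_elem
    intro w
    change cT b w _ = cT b w _
    rw [cT_reindex, hB, hB, mw_perm]
  choose X hX using h1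
  refine ⟨∑ S : Set.powersetCard ι ℓ, X (fun m => F m (Set.powersetCard.ofFinEmbEquiv.symm S)) ⊗ₜ
    b.exteriorPower ℓ S, fun w s hs => ?_⟩
  obtain ⟨T, hT⟩ : ∃ T : Set.powersetCard ι ℓ, s = Set.powersetCard.ofFinEmbEquiv.symm T :=
    ⟨Set.powersetCard.ofFinEmbEquiv (OrderEmbedding.ofStrictMono s hs), by simp⟩
  simp only [incl, map_sum, TensorProduct.map_tmul, C_tmul, Submodule.subtype_apply, hX,
    LinearMap.id_apply]
  rw [Finset.sum_eq_single T]
  · rw [hT, ← cL_eq_repr]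
    simp
  · intro S _ hST
    rw [hT, ← cL_eq_repr, Basis.repr_self, Finsupp.single_eq_of_ne hST.symm, mul_zero]
  · simp

end coords

end DualKoszul

theorem dual_koszul_complex_exact {R : Type*} [CommRing R] {V : Type*} [AddCommGroup V]
    [Module R V] [Module.Free R V] [Module.Finite R V]
    (d : ∀ k ℓ : ℕ, (DivPow R V (k + 1)) ⊗[R] (⋀[R]^ℓ V) →ₗ[R]
      (DivPow R V k) ⊗[R] (⋀[R]^(ℓ + 1) V))
    (E : ∀ k ℓ : ℕ, (⨂[R] (_ : Fin (k + 1)), V) ⊗[R] (⋀[R]^ℓ V) →ₗ[R]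
      (⨂[R] (_ : Fin k), V) ⊗[R] (⋀[R]^(ℓ + 1) V))
    (hE : ∀ (k ℓ : ℕ) (v : Fin (k + 1) → V) (w : Fin ℓ → V),
      E k ℓ ((tprod R v) ⊗ₜ[R]
          (⟨ExteriorAlgebra.ιMulti R ℓ w,
            ExteriorAlgebra.ιMulti_range R ℓ (Set.mem_range_self w)⟩ : ⋀[R]^ℓ V)) =
        (tprod R (v ∘ Fin.castSucc)) ⊗ₜ[R]
          (⟨ExteriorAlgebra.ιMulti R (ℓ + 1) (Fin.cons (v (Fin.last k)) w),
            ExteriorAlgebra.ιMulti_range R (ℓ + 1) (Set.mem_range_self _)⟩ : ⋀[R]^(ℓ + 1) V))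
    (hcompat : ∀ k ℓ : ℕ,
      (TensorProduct.map (DivPow R V k).subtype LinearMap.id).comp (d k ℓ) =
        (E k ℓ).comp (TensorProduct.map (DivPow R V (k + 1)).subtype LinearMap.id)) :
    (∀ k ℓ : ℕ, LinearMap.range (d (k + 1) ℓ) = LinearMap.ker (d k (ℓ + 1))) ∧
    (∀ m : ℕ, Function.Injective (d m 0)) ∧
    (∀ m : ℕ, Function.Surjective (d 0 m)) := by
  classical
  let b0 := Module.Free.chooseBasis R V
  let b := b0.reindex (Fintype.equivFin _)
  have hd : ∀ (k ℓ : ℕ) (x : (DivPow R V (k + 1)) ⊗[R] (⋀[R]^ℓ V)) (w) (s : Fin (ℓ + 1) → _),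
      DualKoszul.C b w s (DualKoszul.incl R V k (ℓ + 1) (d k ℓ x)) =
      ∑ j : Fin (ℓ + 1), (-1) ^ (j : ℕ) * DualKoszul.C b (Fin.snoc w (s j) : Fin (k + 1) → _) (j.removeNth s)
        (DualKoszul.incl R V (k + 1) ℓ x) := by
    intro k ℓ x w s
    rw [← DualKoszul.C_E b (E k ℓ) (hE k ℓ) w s]
    exact congrArg _ (LinearMap.congr_fun (hcompat k ℓ) x)
  -- the differential in coordinates
  have hdF : ∀ (k ℓ : ℕ) (x : (DivPow R V (k + 1)) ⊗[R] (⋀[R]^ℓ V))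
      (F : Multiset _ → (Fin ℓ → _) → R)
      (_ : ∀ w s, DualKoszul.C b w s (DualKoszul.incl R V (k + 1) ℓ x) = F (DualKoszul.mw w) s)
      (w : Fin k → _) (s : Fin (ℓ + 1) → _),
      DualKoszul.C b w s (DualKoszul.incl R V k (ℓ + 1) (d k ℓ x)) =
        DualKoszul.dc F (DualKoszul.mw w) s := by
    intro k ℓ x F hF w s
    rw [hd, DualKoszul.dc]
    refine Finset.sum_congr rfl fun j _ => ?_
    rw [hF, DualKoszul.mw_snoc]
  -- the same, on strictly increasing indices
  have hdFs : ∀ (k ℓ : ℕ) (x : (DivPow R V (k + 1)) ⊗[R] (⋀[R]^ℓ V))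
      (F : Multiset _ → (Fin ℓ → _) → R)
      (_ : ∀ w s, StrictMono s →
        DualKoszul.C b w s (DualKoszul.incl R V (k + 1) ℓ x) = F (DualKoszul.mw w) s)
      (w : Fin k → _) (s : Fin (ℓ + 1) → _), StrictMono s →
      DualKoszul.C b w s (DualKoszul.incl R V k (ℓ + 1) (d k ℓ x)) =
        DualKoszul.dc F (DualKoszul.mw w) s := by
    intro k ℓ x F hF w s hs
    rw [hd, DualKoszul.dc]
    refine Finset.sum_congr rfl fun j _ => ?_
    rw [hF _ (j.removeNth s) (hs.comp (Fin.strictMono_succAbove j)), DualKoszul.mw_snoc]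
  have hker : ∀ (k ℓ : ℕ) (x : (DivPow R V (k + 1)) ⊗[R] (⋀[R]^ℓ V)) (_ : d k ℓ x = 0)
      (F : Multiset _ → (Fin ℓ → _) → R)
      (_ : ∀ w s, DualKoszul.C b w s (DualKoszul.incl R V (k + 1) ℓ x) = F (DualKoszul.mw w) s)
      (m : Multiset _) (s : Fin (ℓ + 1) → _), m.card = k → DualKoszul.dc F m s = 0 := by
    intro k ℓ x hx F hF m s hm
    obtain ⟨w, rfl⟩ := DualKoszul.exists_word m hm
    rw [← hdF k ℓ x F hF, hx, map_zero, map_zero]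
  refine ⟨fun k ℓ => le_antisymm ?_ ?_, fun m => ?_, fun m => ?_⟩
  · rintro _ ⟨x, rfl⟩
    rw [LinearMap.mem_ker]
    obtain ⟨F, hF⟩ := DualKoszul.exists_F b x
    apply DualKoszul.incl_injective b
    apply DualKoszul.C_sep b
    intro w s _
    rw [map_zero, map_zero, hdF k (ℓ + 1) _ _ (hdF (k + 1) ℓ x F hF), DualKoszul.dc_dc]
  · intro x hx
    rw [LinearMap.mem_ker] at hx
    obtain ⟨F, hF⟩ := DualKoszul.exists_F b x
    obtain ⟨y, hy⟩ := DualKoszul.exists_real b (k + 2) (DualKoszul.hc F)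
    refine ⟨y, ?_⟩
    apply DualKoszul.incl_injective b
    apply DualKoszul.C_sep b
    intro w s hs
    rw [hdFs (k + 1) ℓ y _ hy w s hs, hF, ← DualKoszul.homotopy F _ s hs,
      DualKoszul.hc_zero (DualKoszul.dc F) (hker k (ℓ + 1) x hx F hF) _ (DualKoszul.card_mw w),
      add_zero]
  · refine DualKoszul.inj_of_ker (d m 0) ?_
    intro x hx
    obtain ⟨F, hF⟩ := DualKoszul.exists_F b x
    apply DualKoszul.incl_injective b
    apply DualKoszul.C_sep b
    intro w s hs
    rw [map_zero, map_zero, hF, ← DualKoszul.homotopy_zero F,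
      DualKoszul.hc_zero (DualKoszul.dc F) (hker m 0 x hx F hF) _ (DualKoszul.card_mw w)]
    intro h0
    have := DualKoszul.card_mw w
    rw [h0] at this
    simp at this
  · intro x
    obtain ⟨F, hF⟩ := DualKoszul.exists_F b x
    obtain ⟨y, hy⟩ := DualKoszul.exists_real b 1 (DualKoszul.hc F)
    refine ⟨y, ?_⟩
    apply DualKoszul.incl_injective b
    apply DualKoszul.C_sep b
    intro w s hs
    rw [hdFs 0 m y _ hy w s hs, hF, ← DualKoszul.homotopy F _ s hs,
      DualKoszul.hc_of_not (DualKoszul.dc F), add_zero]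
    rintro ⟨i, hi, -⟩
    simp [DualKoszul.mw] at hi
end
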